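/- Assume T > R > P > S, 2R > T + S, 0 ≤ γ < 1 and γ² > (T−R)/(T−P). Let n ≥ 2 and let τ : (Fin n → Ω) → {C,D} be the memory-n retarded Grim strategy: τ h = C if h 1 = (C,C) and τ h = D otherwise. Then there exists Q : {C,D} × (Fin n → Ω) → ℝ satisfying the player-1 memory-n Bellman optimality equation against τ such that for every history h: if h 1 = (C,C) then Q(C,h) > Q(D,h), and otherwise Q(D,h) > Q(C,h); that is, a pair of retarded Grim strategies remains a symmetric mutual reinforcement learning equilibrium under memory-n reinforcement learning for every n ≥ 2. -/

import Mathlib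

inductive Act where
  | C : Act
  | D : Act
deriving DecidableEq

open Act

abbrev St : Type := Act × Act

/-- Player 1's payoff in the prisoner's dilemma. -/
def r1 (R S T P : ℝ) : Act → Act → ℝ
  | C, C => R
  | C, D => S
  | D, C => T
  | D, D => P

/-- Prepend the new state `(σ, σ2)` to a memory-`n` history, discarding the oldest state. -/
def push {n : ℕ} (σ σ2 : Act) (h : Fin n → St) : Fin n → St := fun i =>
  if (i : ℕ) = 0 then (σ, σ2)
  else h ⟨(i : ℕ) - 1, Nat.lt_of_le_of_lt (Nat.sub_le _ _) i.isLt⟩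

/-- Restrict a memory-`n` history to its `n'` most recent states (`n' ≤ n`). -/
def restrict {n n' : ℕ} (hle : n' ≤ n) (h : Fin n → St) : Fin n' → St := fun i =>
  h ⟨(i : ℕ), Nat.lt_of_lt_of_le i.isLt hle⟩

/-- Value of a position of retarded Grim against itself, where `a` and `b` say that the most recent
and the second-to-last states are `(C, C)`. -/
noncomputable def grimValue (R P γ : ℝ) (a b : Prop) [Decidable a] [Decidable b] : ℝ :=
  if b then (if a then R / (1 - γ) else (R + γ * P) / (1 - γ ^ 2))
  else (if a then (P + γ * R) / (1 - γ ^ 2) else P / (1 - γ))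

theorem push_zero {n : ℕ} (hn : 0 < n) (σ σ2 : Act) (h : Fin n → St) :
    push σ σ2 h ⟨0, hn⟩ = (σ, σ2) := by
  simp [push]

theorem push_one {n : ℕ} (hn : 1 < n) (σ σ2 : Act) (h : Fin n → St) :
    push σ σ2 h ⟨1, hn⟩ = h ⟨0, Nat.zero_lt_of_lt hn⟩ := by
  simp [push]

/-- The discounted gain from future cooperation exceeds the temptation `T - R`. -/
theorem temptation_lt_discounted_gain {R T P γ : ℝ} (hTR : T > R) (hRP : R > P) (hγ0 : 0 ≤ γ)
    (hγ1 : γ < 1) (hγ2 : γ ^ 2 > (T - R) / (T - P)) :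
    T - R < γ ^ 2 * (R - P) / (1 - γ ^ 2) := by
  have h1 : 0 < 1 - γ ^ 2 := by nlinarith
  rw [gt_iff_lt, div_lt_iff₀ (by linarith)] at hγ2
  rw [lt_div_iff₀ h1]
  linarith

/-- the memory-`n` retarded Grim strategy (cooperate iff the second-to-last
state was `(C,C)`) forms a symmetric mutual reinforcement learning equilibrium under memory-`n`
reinforcement learning, for every `n ≥ 2`, when `γ² > (T−R)/(T−P)`. -/
theorem stmt_15 (R S T P γ : ℝ) (hTR : T > R) (hRP : R > P) (hPS : P > S)
    (h2R : 2 * R > T + S) (hγ0 : 0 ≤ γ) (hγ1 : γ < 1)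
    (hγ2 : γ ^ 2 > (T - R) / (T - P))
    (n : ℕ) (hn : 2 ≤ n)
    (τ : (Fin n → St) → Act)
    (hτ : ∀ h : Fin n → St, τ h = if h ⟨1, hn⟩ = (C, C) then C else D) :
    ∃ Q : Act → (Fin n → St) → ℝ,
      (∀ σ (h : Fin n → St), Q σ h =
        r1 R S T P σ (τ h) +
          γ * max (Q C (push σ (τ h) h)) (Q D (push σ (τ h) h))) ∧
      (∀ h : Fin n → St,
        (h ⟨1, hn⟩ = (C, C) → Q C h > Q D h) ∧
        (h ⟨1, hn⟩ ≠ (C, C) → Q D h > Q C h)) := by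
  have h0 : 0 < n := by omega
  have hd1 : 1 - γ ≠ 0 := by linarith
  have hd2 : 1 + γ ≠ 0 := by linarith
  have hf : 1 - γ ^ 2 = (1 - γ) * (1 + γ) := by ring
  have key := temptation_lt_discounted_gain hTR hRP hγ0 hγ1 hγ2
  let V : (Fin n → St) → ℝ := fun h => grimValue R P γ (h ⟨0, h0⟩ = (C, C)) (h ⟨1, hn⟩ = (C, C))
  let Q : Act → (Fin n → St) → ℝ := fun σ h => r1 R S T P σ (τ h) + γ * V (push σ (τ h) h)
  have hlt : ∀ h : Fin n → St,
      (h ⟨1, hn⟩ = (C, C) → Q C h > Q D h) ∧ (h ⟨1, hn⟩ ≠ (C, C) → Q D h > Q C h) := by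
    intro h
    by_cases hb : h ⟨1, hn⟩ = (C, C) <;> by_cases ha : h ⟨0, h0⟩ = (C, C) <;>
      simp only [Q, V, grimValue, hτ, push_zero, push_one, ha, hb, r1] <;> simp
    · have e : γ * (R / (1 - γ)) - γ * ((R + γ * P) / (1 - γ ^ 2))
          = γ ^ 2 * (R - P) / (1 - γ ^ 2) := by
        rw [hf]; field_simp; ring
      linarith
    · have e : γ * ((P + γ * R) / (1 - γ ^ 2)) - γ * (P / (1 - γ))
          = γ ^ 2 * (R - P) / (1 - γ ^ 2) := by
        rw [hf]; field_simp; ring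
      linarith
    · exact fun _ => hPS
    · exact fun _ => hPS
  have hmax : ∀ h, max (Q C h) (Q D h) = V h := by
    intro h
    by_cases hb : h ⟨1, hn⟩ = (C, C)
    · rw [max_eq_left ((hlt h).1 hb).le]
      by_cases ha : h ⟨0, h0⟩ = (C, C) <;>
        simp [Q, V, grimValue, hτ, push_zero, push_one, ha, hb, r1, hf] <;> field_simp <;> ring
    · rw [max_eq_right ((hlt h).2 hb).le]
      by_cases ha : h ⟨0, h0⟩ = (C, C) <;>
        simp [Q, V, grimValue, hτ, push_zero, push_one, ha, hb, r1, hf] <;> field_simp <;> ring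
  exact ⟨Q, fun σ h => by rw [hmax], hlt⟩
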